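/- arXiv:1407.4825 — 2 statements merged into one kernel-verified Lean document; each statement's English description precedes it below -/
import Mathlib

section
/- The first Hochschild cohomology HH^1(A_1, A_1) of the algebra A_1 = ℂ⟨x,y⟩/(xy − yx − x) with coefficients in itself is nonzero. In particular, A_1 admits a nonzero outer derivation. -/
noncomputable section

/-- The free algebra `ℂ⟨x,y⟩` on two generators. -/
abbrev FreeTwo : Type := FreeAlgebra ℂ (Fin 2)

/-- The generator `x`. -/
def Xgen : FreeTwo := FreeAlgebra.ι ℂ 0

/-- The generator `y`. -/
def Ygen : FreeTwo := FreeAlgebra.ι ℂ 1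

/-- The relation `x·(a·y) = (a·y)·x + x`, i.e. `x·a·y − a·y·x − x = 0`. -/
def relA (a : ℂ) : FreeTwo → FreeTwo → Prop := fun p q =>
  p = Xgen * (a • Ygen) ∧ q = (a • Ygen) * Xgen + Xgen

/-- The algebra `A_a = ℂ⟨x,y⟩/(x·a·y − a·y·x − x)`. -/
abbrev Aalg (a : ℂ) : Type := RingQuot (relA a)

/-- The quotient map `ℂ⟨x,y⟩ → A_a`. -/
def mkA (a : ℂ) : FreeTwo →ₐ[ℂ] Aalg a := RingQuot.mkAlgHom ℂ (relA a)


open CategoryTheory TensorProduct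

/-- The algebra `A_1 = ℂ⟨x,y⟩/(xy − yx − x)`. -/
abbrev A1 : Type := Aalg 1

/-- The enveloping algebra `A_1^e = A_1 ⊗_ℂ A_1^op`. -/
abbrev A1e : Type := A1 ⊗[ℂ] A1ᵐᵒᵖ

attribute [local instance] TensorProduct.Algebra.module

/-- Hochschild cohomology `HH^n(A_1, M) = Ext^n_{A_1^e}(A_1, M)`. -/
def HH1alg (n : ℕ) (M : ModuleCat.{0} A1e) : ModuleCat ℂ :=
  ((Ext ℂ (ModuleCat.{0} A1e) n).obj (Opposite.op (ModuleCat.of A1e A1))).obj M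

/-- If `Ext¹(X, Y)` vanishes, then every extension of `X` by `Y` splits. -/
theorem exists_section_of_subsingleton_Ext_one {R : Type*} [Ring R] {C : Type*} [Category* C]
    [Abelian C] [Linear R C] [EnoughProjectives C] {S : ShortComplex C} (hS : S.ShortExact)
    (h : Subsingleton (((Ext R C 1).obj (Opposite.op S.X₃)).obj S.X₁)) :
    ∃ s : S.X₃ ⟶ S.X₂, s ≫ S.g = 𝟙 S.X₃ := by
  have := hS.mono_f
  have := hS.epi_g
  let P := ProjectiveResolution.of S.X₃
  let ε : P.complex.X 0 ⟶ S.X₃ := P.π.f 0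
  have hdε : P.complex.d 1 0 ≫ ε = 0 := P.complex_d_comp_π_f_zero
  let φ : P.complex.X 0 ⟶ S.X₂ := Projective.factorThru ε S.g
  have hφ : φ ≫ S.g = ε := Projective.factorThru_comp _ _
  let f : P.complex.X 1 ⟶ S.X₁ := hS.exact.lift (P.complex.d 1 0 ≫ φ) (by simp [hφ, hdε])
  have hf : f ≫ S.f = P.complex.d 1 0 ≫ φ := hS.exact.lift_f _ _
  have hdf : P.complex.d 2 1 ≫ f = 0 := by
    rw [← cancel_mono S.f]
    simp [hf]
  have hex : (P.complex.linearYonedaObj R S.X₁).ExactAt 1 := by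
    rw [HomologicalComplex.exactAt_iff_isZero_homology]
    exact (ModuleCat.isZero_of_subsingleton _).of_iso (P.isoExt 1 S.X₁).symm
  rw [HomologicalComplex.exactAt_iff' _ 0 1 2 (by simp) (by simp),
    ShortComplex.moduleCat_exact_iff] at hex
  obtain ⟨g, hg⟩ : ∃ g : P.complex.X 0 ⟶ S.X₁, P.complex.d 1 0 ≫ g = f := hex f hdf
  have hk : P.complex.d 1 0 ≫ (φ - g ≫ S.f) = 0 := by
    rw [Preadditive.comp_sub, ← Category.assoc, hg, hf, sub_self]
  have : Epi ε := inferInstanceAs (Epi (P.π.f 0))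
  obtain ⟨s, hs⟩ : ∃ s : S.X₃ ⟶ S.X₂, ε ≫ s = φ - g ≫ S.f :=
    ⟨P.exact₀.desc _ hk, P.exact₀.g_desc _ hk⟩
  refine ⟨s, ?_⟩
  rw [← cancel_epi ε, ← Category.assoc, hs]
  simp [hφ]

namespace A1

/-- The class of `x` in `A_1`. -/
def x : A1 := mkA 1 Xgen

/-- The class of `y` in `A_1`. -/
def y : A1 := mkA 1 Ygen

theorem x_mul_y : x * y = y * x + x := by
  have h := RingQuot.mkAlgHom_rel ℂ (s := relA 1) ⟨rfl, rfl⟩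
  simpa [x, y, mkA] using h

section Lift

variable {B : Type*} [Ring B] [Algebra ℂ B]

/-- Elements `p`, `q` with `pq = qp + p` determine an algebra map out of `A_1`. -/
def lift (p q : B) (h : p * q = q * p + p) : A1 →ₐ[ℂ] B :=
  RingQuot.liftAlgHom ℂ ⟨FreeAlgebra.lift ℂ ![p, q], by
    rintro _ _ ⟨rfl, rfl⟩
    simpa [Xgen, Ygen] using h⟩

@[simp]
theorem lift_x (p q : B) (h : p * q = q * p + p) : lift p q h x = p := by
  simp [lift, x, mkA, Xgen]

@[simp]
theorem lift_y (p q : B) (h : p * q = q * p + p) : lift p q h y = q := by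
  simp [lift, y, mkA, Ygen]

theorem algHom_ext {f g : A1 →ₐ[ℂ] B} (hx : f x = g x) (hy : f y = g y) : f = g := by
  apply RingQuot.ringQuot_ext'
  apply FreeAlgebra.hom_ext
  funext i
  fin_cases i
  · exact hx
  · exact hy

end Lift

/-- The algebra map `a ↦ a + ε D(a)` into the dual numbers over `A_1`, where `D` is the
derivation with `D(x) = 0` and `D(y) = 1`. -/
def toDual : A1 →ₐ[ℂ] TrivSqZeroExt A1 A1 :=
  lift (TrivSqZeroExt.inl x) (TrivSqZeroExt.inl y + TrivSqZeroExt.inr 1) (by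
    ext <;> simp [x_mul_y])

theorem fst_toDual (a : A1) : (toDual a).fst = a := by
  have h : (TrivSqZeroExt.fstHom ℂ A1 A1).comp toDual = AlgHom.id ℂ A1 :=
    algHom_ext (by simp [toDual]) (by simp [toDual])
  exact DFunLike.congr_fun h a

/-- The derivation of `A_1` with `x ↦ 0` and `y ↦ 1`. -/
def derivY : A1 →ₗ[ℂ] A1 := (TrivSqZeroExt.sndHom A1 A1).restrictScalars ℂ ∘ₗ toDual.toLinearMap

theorem snd_toDual (a : A1) : (toDual a).snd = derivY a := rfl

theorem derivY_mul (a b : A1) : derivY (a * b) = derivY a * b + a * derivY b := by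
  rw [← snd_toDual, map_mul, TrivSqZeroExt.snd_mul, fst_toDual, fst_toDual, snd_toDual, snd_toDual]
  simp [add_comm]

theorem derivY_y : derivY y = 1 := by
  simp [← snd_toDual, toDual]

/-- The augmentation `A_1 → ℂ`, `x, y ↦ 0`. -/
def augmentation : A1 →ₐ[ℂ] ℂ := lift 0 0 (by simp)

theorem derivY_ne_zero : derivY ≠ 0 := by
  intro h
  have := congrArg augmentation derivY_y
  simp [h] at this

theorem derivY_not_inner : ¬ ∃ u : A1, ∀ a : A1, derivY a = u * a - a * u := by
  rintro ⟨u, hu⟩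
  have := congrArg augmentation ((hu y).symm.trans derivY_y)
  simp [mul_comm] at this

/-- The dual numbers over `A_1`, as the bimodule with left action through `toDual` and right
action through the scalar inclusion. -/
def Twisted : Type := TrivSqZeroExt A1 A1

instance : AddCommGroup Twisted := inferInstanceAs (AddCommGroup (TrivSqZeroExt A1 A1))

/-- The action of the enveloping algebra on `Twisted`. -/
def twistedAction : A1e →ₐ[ℂ] Module.End ℂ (TrivSqZeroExt A1 A1) :=
  Algebra.TensorProduct.lift ((Algebra.lmul ℂ (TrivSqZeroExt A1 A1)).comp toDual)
    (AlgHom.ofLinearMap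
      ((LinearMap.mul ℂ (TrivSqZeroExt A1 A1)).flip ∘ₗ
        (TrivSqZeroExt.inlAlgHom ℂ A1 A1).toLinearMap ∘ₗ
        (MulOpposite.opLinearEquiv ℂ).symm.toLinearMap)
      (by ext1 t; simp)
      (fun a b => by
        refine LinearMap.ext fun t => ?_
        simp [mul_assoc]))
    (fun a b => LinearMap.ext fun t => by simp [mul_assoc])

theorem twistedAction_tmul (a : A1) (b : A1ᵐᵒᵖ) (t : TrivSqZeroExt A1 A1) :
    twistedAction (a ⊗ₜ[ℂ] b) t = toDual a * (t * TrivSqZeroExt.inl b.unop) :=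
  LinearMap.congr_fun (Algebra.TensorProduct.lift_tmul _ _ _ a b) t

theorem toDual_mul_inr_mul_inl (a b m : A1) :
    toDual a * (TrivSqZeroExt.inr m * TrivSqZeroExt.inl b) = TrivSqZeroExt.inr (a * (m * b)) := by
  apply TrivSqZeroExt.ext
  · simp only [TrivSqZeroExt.fst_mul, TrivSqZeroExt.fst_inr, zero_mul, mul_zero]
  · simp only [TrivSqZeroExt.snd_mul, TrivSqZeroExt.fst_mul, TrivSqZeroExt.fst_inr,
      TrivSqZeroExt.snd_inr, TrivSqZeroExt.fst_inl, TrivSqZeroExt.snd_inl, fst_toDual]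
    simp

theorem fst_toDual_mul_mul_inl (a b : A1) (t : TrivSqZeroExt A1 A1) :
    (toDual a * (t * TrivSqZeroExt.inl b)).fst = a * (t.fst * b) := by
  rw [TrivSqZeroExt.fst_mul, TrivSqZeroExt.fst_mul, fst_toDual, TrivSqZeroExt.fst_inl]

instance : Module A1e Twisted :=
  Module.compHom (TrivSqZeroExt A1 A1) twistedAction.toRingHom

theorem tmul_smul_twisted (a : A1) (b : A1ᵐᵒᵖ) (t : TrivSqZeroExt A1 A1) :
    @HSMul.hSMul A1e Twisted Twisted _ (a ⊗ₜ[ℂ] b) t =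
      toDual a * (t * TrivSqZeroExt.inl b.unop) :=
  twistedAction_tmul a b t

theorem tmul_smul (a : A1) (b : A1ᵐᵒᵖ) (m : A1) : (a ⊗ₜ[ℂ] b) • m = a * (m * b.unop) := rfl

/-- An additive map between modules over the enveloping algebra that commutes with the action of
pure tensors is linear. -/
def linearMapOfTmul {M N : Type*} [AddCommGroup M] [AddCommGroup N] [Module A1e M] [Module A1e N]
    (f : M →+ N)
    (h : ∀ (a : A1) (b : A1ᵐᵒᵖ) (m : M), f ((a ⊗ₜ[ℂ] b) • m) = (a ⊗ₜ[ℂ] b) • f m) :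
    M →ₗ[A1e] N where
  __ := f
  map_smul' r m := by
    induction r using TensorProduct.induction_on with
    | zero => exact ((congrArg f (zero_smul A1e m)).trans f.map_zero).trans (zero_smul A1e (f m)).symm
    | tmul a b => exact h a b m
    | add r s hr hs => simpa [add_smul] using congrArg₂ (· + ·) hr hs

/-- The inclusion `m ↦ ε m`. -/
def twistedInr : A1 →ₗ[A1e] Twisted :=
  linearMapOfTmul (TrivSqZeroExt.inrHom A1 A1).toAddMonoidHom fun a b m =>
    ((tmul_smul_twisted a b (TrivSqZeroExt.inr m)).trans
      (toDual_mul_inr_mul_inl a b.unop m)).symm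

/-- The projection `m + ε n ↦ m`. -/
def twistedFst : Twisted →ₗ[A1e] A1 :=
  linearMapOfTmul (TrivSqZeroExt.fstHom ℂ A1 A1 : TrivSqZeroExt A1 A1 →+ A1) fun a b t =>
    (congrArg TrivSqZeroExt.fst (tmul_smul_twisted a b t)).trans
      (fst_toDual_mul_mul_inl a b.unop t)

/-- The extension of `A_1` by itself defined by `derivY`. -/
def twistedExtension : ShortComplex (ModuleCat.{0} A1e) :=
  ShortComplex.mk (X₁ := ModuleCat.of A1e A1) (X₃ := ModuleCat.of A1e A1)
    (ModuleCat.ofHom twistedInr) (ModuleCat.ofHom twistedFst) (by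
      ext m
      exact TrivSqZeroExt.fst_inr A1 m)

theorem twistedExtension_shortExact : twistedExtension.ShortExact where
  exact := by
    rw [ShortComplex.moduleCat_exact_iff]
    intro t (ht : TrivSqZeroExt.fst t = 0)
    exact ⟨TrivSqZeroExt.snd t, TrivSqZeroExt.ext ht.symm rfl⟩
  mono_f := (ModuleCat.mono_iff_injective _).2 TrivSqZeroExt.inr_injective
  epi_g := (ModuleCat.epi_iff_surjective _).2 fun m =>
    ⟨(TrivSqZeroExt.inl m : TrivSqZeroExt A1 A1), rfl⟩

/-- A section of the twisted extension exhibits `derivY` as inner. -/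
theorem derivY_inner_of_section (s : A1 →ₗ[A1e] Twisted) (hs : ∀ a, twistedFst (s a) = a) :
    ∃ u : A1, ∀ a : A1, derivY a = u * a - a * u := by
  let e : TrivSqZeroExt A1 A1 := s 1
  have he : e.fst = 1 := hs 1
  refine ⟨e.snd, fun a => ?_⟩
  have key : (a ⊗ₜ[ℂ] (1 : A1ᵐᵒᵖ)) • s 1 = ((1 : A1) ⊗ₜ[ℂ] MulOpposite.op a) • s 1 := by
    rw [← map_smul, ← map_smul, tmul_smul, tmul_smul]
    simp
  have h : (toDual a * (e * TrivSqZeroExt.inl 1)).snd =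
      (toDual 1 * (e * TrivSqZeroExt.inl a)).snd :=
    congrArg TrivSqZeroExt.snd
      ((tmul_smul_twisted a 1 e).symm.trans (key.trans (tmul_smul_twisted 1 (.op a) e)))
  simp [he, fst_toDual, snd_toDual] at h
  rw [← h]
  simp

end A1

/-- `HH^1(A_1, A_1) ≠ 0`; in particular `A_1` admits a nonzero derivation which is
not inner. -/
theorem HH1_A1_nonzero :
    Nontrivial (HH1alg 1 (ModuleCat.of A1e A1)) ∧
    ∃ D : A1 →ₗ[ℂ] A1,
      (∀ a b : A1, D (a * b) = D a * b + a * D b) ∧ D ≠ 0 ∧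
      ¬ ∃ u : A1, ∀ a : A1, D a = u * a - a * u := by
  refine ⟨?_, A1.derivY, A1.derivY_mul, A1.derivY_ne_zero, A1.derivY_not_inner⟩
  by_contra h
  obtain ⟨s, hs⟩ := exists_section_of_subsingleton_Ext_one A1.twistedExtension_shortExact
    (not_nontrivial_iff_subsingleton.1 h)
  exact A1.derivY_not_inner (A1.derivY_inner_of_section s.hom fun a =>
    congrArg (fun f => f.hom a) hs)
end
end

section
/- There exists an (A_1, A_1)-bimodule M such that HH^2(A_1, M) ≠ 0, where A_1 = ℂ⟨x,y⟩/(xy − yx − x); hence HCDim(A_1) = 2. -/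
noncomputable section

open CategoryTheory TensorProduct

attribute [local instance] TensorProduct.Algebra.module

/-- The Hochschild cohomological dimension of `A_1`:
the supremum of `n` such that `HH^n(A_1, M) ≠ 0` for some bimodule `M`. -/
def HCDimA1 : ℕ∞ :=
  sSup {e : ℕ∞ | ∃ n : ℕ, e = n ∧ ∃ M : ModuleCat.{0} A1e, Nontrivial (HH1alg n M)}

/-- The algebra `A` is presented over `k` by the generators `x`, `y` and the relation
`xy = yx + x`. -/
structure IsAffinePresentation (k : Type*) {A : Type*} [CommRing k] [Ring A] [Algebra k A]
    (x y : A) : Prop where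
  rel : x * y = y * x + x
  adjoin_eq_top : Algebra.adjoin k {x, y} = ⊤
  exists_lift : ∀ {B : Type} [Ring B] [Algebra k B] (u v : B), u * v = v * u + u →
    ∃ f : A →ₐ[k] B, f x = u ∧ f y = v

namespace IsAffinePresentation

variable {k A : Type} [CommRing k] [Ring A] [Algebra k A] {x y : A}

theorem induction (h : IsAffinePresentation k x y) {p : A → Prop} (hx : p x) (hy : p y)
    (algebraMap : ∀ c : k, p (algebraMap k A c)) (add : ∀ a b, p a → p b → p (a + b))
    (mul : ∀ a b, p a → p b → p (a * b)) (a : A) : p a := by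
  have ha : a ∈ Algebra.adjoin k {x, y} := h.adjoin_eq_top ▸ Algebra.mem_top
  induction ha using Algebra.adjoin_induction with
  | mem z hz =>
    rcases hz with rfl | rfl
    exacts [hx, hy]
  | algebraMap c => exact algebraMap c
  | add a b _ _ ha hb => exact add a b ha hb
  | mul a b _ _ ha hb => exact mul a b ha hb

section NormalForm

open Polynomial

/-- Multiplication by `x` on normal forms `∑ yʲ xⁱ`, encoded as polynomials in `y` with
coefficients in `k[x]`. -/
def mulX (k : Type) [CommRing k] : Module.End k k[X][X] :=
  LinearMap.mulLeft k (C X) ∘ₗ (taylor (1 : k[X])).restrictScalars k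

/-- Evaluation of the normal form `∑ yʲ xⁱ` in the algebra. -/
def evalNormalForm (k : Type) {A : Type} [CommRing k] [Ring A] [Algebra k A] (x y : A) :
    k[X][X] →ₗ[k] A :=
  Polynomial.lsum fun j => LinearMap.mulLeft k (y ^ j) ∘ₗ (aeval x).toLinearMap

theorem evalNormalForm_monomial (j : ℕ) (r : k[X]) :
    evalNormalForm k x y (monomial j r) = y ^ j * aeval x r := by
  simp [evalNormalForm, Polynomial.lsum]

theorem evalNormalForm_X_mul (p : k[X][X]) :
    evalNormalForm k x y (X * p) = y * evalNormalForm k x y p := by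
  induction p using Polynomial.induction_on' with
  | add p q hp hq => simp only [mul_add, map_add, hp, hq]
  | monomial n a =>
    rw [X_mul_monomial, evalNormalForm_monomial, evalNormalForm_monomial, pow_succ', mul_assoc]

theorem evalNormalForm_mulX (hxy : x * y = y * x + x) (p : k[X][X]) :
    evalNormalForm k x y (mulX k p) = x * evalNormalForm k x y p := by
  induction p using Polynomial.induction_on with
  | C a =>
    have hC (r : k[X]) : evalNormalForm k x y (C r) = aeval x r := by
      simpa using evalNormalForm_monomial (x := x) (y := y) 0 r
    simp [mulX, ← C_mul, hC, -map_mul]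
    simp
  | add p q hp hq => simp only [mul_add, map_add, hp, hq]
  | monomial n a ih =>
    have h1 : C a * X ^ (n + 1) = X * (C a * X ^ n) := by ring
    have h2 (q : k[X][X]) : mulX k (X * q) = X * mulX k q + mulX k q := by
      simp [mulX]
      ring
    rw [h1, h2, map_add, evalNormalForm_X_mul, evalNormalForm_X_mul, ih, ← mul_assoc, ← mul_assoc,
      hxy, add_mul]

theorem exists_normalForm (h : IsAffinePresentation k x y) :
    ∃ φ : A →ₗ[k] k[X][X], (∀ b, φ (y * b) = X * φ b) ∧
      evalNormalForm k x y ∘ₗ φ = LinearMap.id := by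
  obtain ⟨f, hx, hy⟩ := h.exists_lift (mulX k) (LinearMap.mulLeft k (X : k[X][X])) (by
    ext1 p
    simp [mulX]
    ring)
  refine ⟨LinearMap.applyₗ 1 ∘ₗ f.toLinearMap, fun b => by simp [hy], ?_⟩
  have key (a : A) : ∀ p, evalNormalForm k x y (f a p) = a * evalNormalForm k x y p := by
    induction a using h.induction with
    | hx => simp [hx, evalNormalForm_mulX h.rel]
    | hy => simp [hy, evalNormalForm_X_mul]
    | algebraMap c =>
      intro p
      rw [AlgHom.commutes, Module.algebraMap_end_apply, map_smul, Algebra.smul_def]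
    | add a b ha hb => simp [ha, hb, add_mul]
    | mul a b ha hb => simp [ha, hb, mul_assoc]
  ext a
  have h1 := evalNormalForm_monomial (k := k) (x := x) (y := y) 0 1
  simp only [monomial_zero_left, map_one, pow_zero, mul_one] at h1
  simp [key, h1]

end NormalForm

open MulOpposite

theorem eq_zero_of_mul_eq_zero (h : IsAffinePresentation k x y) (u : A ⊗[k] Aᵐᵒᵖ)
    (hu : u * (1 ⊗ₜ op y - y ⊗ₜ 1 - 1) = 0) : u = 0 := by
  obtain ⟨φ, hφ, hinv⟩ := h.exists_normalForm
  let R := Polynomial k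
  let Φ : A ⊗[k] Aᵐᵒᵖ →ₗ[k] A ⊗[k] Polynomial R :=
    LinearMap.lTensor A (φ ∘ₗ (opLinearEquiv k).symm.toLinearMap)
  let E : A ⊗[k] Polynomial R ≃ₗ[k] A ⊗[k] (ℕ →₀ R) :=
    LinearEquiv.lTensor A ((Polynomial.basisMonomials R).repr.restrictScalars k)
  let Θ : A ⊗[k] Aᵐᵒᵖ →ₗ[k] (ℕ →₀ A ⊗[k] R) :=
    (finsuppRight k k A R ℕ).toLinearMap ∘ₗ E.toLinearMap ∘ₗ Φ
  have hΘ (a b : A) (j : ℕ) : Θ (a ⊗ₜ op b) j = a ⊗ₜ (φ b).coeff j := by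
    simp [Θ, Φ, E, finsuppRight_apply_tmul_apply]
    rfl
  have hΦ : Function.Injective Φ := by
    refine Function.LeftInverse.injective (g := LinearMap.lTensor A
      ((opLinearEquiv k).toLinearMap ∘ₗ evalNormalForm k x y)) fun w => ?_
    rw [← LinearMap.comp_apply, ← LinearMap.lTensor_comp, LinearMap.comp_assoc,
      ← LinearMap.comp_assoc _ φ, hinv]
    simp
  have hΘ_inj : Function.Injective Θ :=
    (finsuppRight k k A R ℕ).injective.comp (E.injective.comp hΦ)
  let T : Module.End k (A ⊗[k] R) := LinearMap.rTensor R (LinearMap.mulRight k y) + 1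
  have hshift (w : A ⊗[k] Aᵐᵒᵖ) (j : ℕ) :
      Θ (w * (1 ⊗ₜ op y - y ⊗ₜ 1 - 1)) (j + 1) = Θ w j - T (Θ w (j + 1)) := by
    induction w with
    | zero => simp
    | add w w' hw hw' =>
      simp only [add_mul, map_add, Finsupp.add_apply, hw, hw']
      abel
    | tmul a b =>
      obtain ⟨b, rfl⟩ := op_surjective b
      simp only [mul_sub, Algebra.TensorProduct.tmul_mul_tmul, mul_one, map_sub,
        Finsupp.sub_apply, ← op_mul, hΘ, hφ, Polynomial.coeff_X_mul]
      simp [T, sub_sub]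
  have hstep (j : ℕ) : Θ u j = T (Θ u (j + 1)) := by
    have := hshift u j
    rw [hu, map_zero, Finsupp.zero_apply] at this
    exact (sub_eq_zero.mp this.symm)
  have hpow (j n : ℕ) : Θ u j = (T ^ n) (Θ u (j + n)) := by
    induction n with
    | zero => simp
    | succ n ih => rw [ih, hstep, pow_succ, Module.End.mul_apply, add_assoc]
  refine hΘ_inj ?_
  ext1 j
  obtain ⟨N, hN⟩ : ∃ N, ∀ n, N ≤ n → Θ u n = 0 := by
    refine ⟨(Θ u).support.sup id + 1, fun n hn => ?_⟩
    by_contra hne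
    have := Finset.le_sup (f := id) (Finsupp.mem_support_iff.mpr hne)
    simp only [id] at this
    omega
  rw [hpow j N, hN _ (Nat.le_add_left _ _)]
  simp

theorem tmul_one_sub_mem_span (h : IsAffinePresentation k x y) (a : A) :
    (a ⊗ₜ 1 - 1 ⊗ₜ op a : A ⊗[k] Aᵐᵒᵖ) ∈
      Ideal.span {x ⊗ₜ 1 - 1 ⊗ₜ op x, (y ⊗ₜ 1 - 1 ⊗ₜ op y : A ⊗[k] Aᵐᵒᵖ)} := by
  induction a using h.induction with
  | hx => exact Ideal.subset_span (by simp)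
  | hy => exact Ideal.subset_span (by simp)
  | algebraMap c =>
    have : (algebraMap k A c ⊗ₜ 1 : A ⊗[k] Aᵐᵒᵖ) = 1 ⊗ₜ op (algebraMap k A c) := by
      simp [Algebra.algebraMap_eq_smul_one, TensorProduct.smul_tmul]
    simp [this]
  | add a b ha hb =>
    convert add_mem ha hb using 1
    rw [TensorProduct.add_tmul, MulOpposite.op_add, TensorProduct.tmul_add]
    abel
  | mul a b ha hb =>
    convert add_mem (Ideal.mul_mem_left _ (a ⊗ₜ 1) hb) (Ideal.mul_mem_left _ (1 ⊗ₜ op b) ha)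
      using 1
    simp [mul_sub]

theorem mem_span_of_smul_one_eq_zero (h : IsAffinePresentation k x y) (u : A ⊗[k] Aᵐᵒᵖ)
    (hu : u • (1 : A) = 0) :
    u ∈ Ideal.span {x ⊗ₜ 1 - 1 ⊗ₜ op x, (y ⊗ₜ 1 - 1 ⊗ₜ op y : A ⊗[k] Aᵐᵒᵖ)} := by
  suffices H : ∀ w : A ⊗[k] Aᵐᵒᵖ, w - 1 ⊗ₜ op (w • (1 : A)) ∈
      Ideal.span {x ⊗ₜ 1 - 1 ⊗ₜ op x, (y ⊗ₜ 1 - 1 ⊗ₜ op y : A ⊗[k] Aᵐᵒᵖ)} by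
    simpa [hu] using H u
  intro w
  induction w with
  | zero =>
    have h0 : (0 : A ⊗[k] Aᵐᵒᵖ) • (1 : A) = 0 :=
      zero_smul (A ⊗[k] Aᵐᵒᵖ) (1 : A)
    rw [h0, MulOpposite.op_zero, TensorProduct.tmul_zero, sub_zero]
    exact zero_mem _
  | add w w' hw hw' =>
    convert add_mem hw hw' using 1
    rw [add_smul, MulOpposite.op_add, TensorProduct.tmul_add]
    abel
  | tmul a b =>
    obtain ⟨b, rfl⟩ := op_surjective b
    convert Ideal.mul_mem_left _ (1 ⊗ₜ op b) (h.tmul_one_sub_mem_span a) using 1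
    simp [mul_sub, TensorProduct.Algebra.smul_def]

theorem exists_retraction (h : IsAffinePresentation k x y) {N : Type} [AddCommGroup N]
    [Module k N] [Module (A ⊗[k] Aᵐᵒᵖ) N] [IsScalarTower k (A ⊗[k] Aᵐᵒᵖ) N] (m n : N)
    (hmn : (1 ⊗ₜ op y - y ⊗ₜ 1 - 1 : A ⊗[k] Aᵐᵒᵖ) • m +
      (x ⊗ₜ 1 - 1 ⊗ₜ op x : A ⊗[k] Aᵐᵒᵖ) • n = 0) :
    ∃ r : A ⊗[k] Aᵐᵒᵖ →ₗ[k] N, ∀ u, r (u * (x ⊗ₜ 1 - 1 ⊗ₜ op x)) = u • m ∧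
      r (u * (y ⊗ₜ 1 - 1 ⊗ₜ op y)) = u • n := by
  let T (a : A) (n : N) : Module.End k (N × A) :=
    { toFun := fun p => ((a ⊗ₜ 1 : A ⊗[k] Aᵐᵒᵖ) • p.1 + (1 ⊗ₜ op p.2 : A ⊗[k] Aᵐᵒᵖ) • n, a * p.2)
      map_add' := fun p q => by
        ext
        · simp only [Prod.fst_add, Prod.snd_add, smul_add, MulOpposite.op_add,
            TensorProduct.tmul_add, add_smul]
          abel
        · simp [mul_add]
      map_smul' := fun c p => by
        ext
        · simp [smul_comm c, TensorProduct.tmul_smul]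
        · simp }
  have T_apply (a : A) (n : N) (p : N × A) : T a n p =
      ((a ⊗ₜ 1 : A ⊗[k] Aᵐᵒᵖ) • p.1 + (1 ⊗ₜ op p.2 : A ⊗[k] Aᵐᵒᵖ) • n, a * p.2) := rfl
  have T_add (a b : A) (n n' : N) : T (a + b) (n + n') = T a n + T b n' := by
    refine LinearMap.ext fun p => ?_
    simp only [T_apply, LinearMap.add_apply, TensorProduct.add_tmul, add_smul, smul_add,
      Prod.mk_add_mk, add_mul]
    congr 1
    abel
  have T_mul (a b : A) (n n' : N) : T a n * T b n' =
      T (a * b) ((a ⊗ₜ 1 : A ⊗[k] Aᵐᵒᵖ) • n' + (1 ⊗ₜ op b : A ⊗[k] Aᵐᵒᵖ) • n) := by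
    refine LinearMap.ext fun p => ?_
    simp only [T_apply, Module.End.mul_apply, smul_add, smul_smul,
      Algebra.TensorProduct.tmul_mul_tmul, mul_one, one_mul, op_mul, mul_assoc, add_assoc]
  have T_algebraMap (c : k) : T (algebraMap k A c) 0 = algebraMap k _ c := by
    refine LinearMap.ext fun p => ?_
    have : (algebraMap k A c ⊗ₜ 1 : A ⊗[k] Aᵐᵒᵖ) = c • 1 := by
      rw [Algebra.algebraMap_eq_smul_one, ← TensorProduct.smul_tmul', Algebra.TensorProduct.one_def]
    rw [T_apply, this, Module.algebraMap_end_apply]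
    ext
    · simp
    · simp [Algebra.smul_def]
  obtain ⟨f, hx, hy⟩ := h.exists_lift (T x m) (T y n) (by
    rw [T_mul, T_mul, ← T_add, ← h.rel]
    congr 1
    rw [← sub_eq_zero, ← hmn]
    simp only [sub_smul, one_smul]
    abel)
  let D : A →ₗ[k] N := LinearMap.fst k N A ∘ₗ LinearMap.applyₗ (0, 1) ∘ₗ f.toLinearMap
  have hD (a : A) (n : N) (ha : f a = T a n) : D a = n := by
    simp [D, ha, T_apply, ← Algebra.TensorProduct.one_def]
  have hf (a : A) : f a = T a (D a) := by
    suffices ∃ n, f a = T a n by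
      obtain ⟨n, hn⟩ := this
      rwa [hD a n hn]
    induction a using h.induction with
    | hx => exact ⟨m, hx⟩
    | hy => exact ⟨n, hy⟩
    | algebraMap c => exact ⟨0, by rw [AlgHom.commutes, T_algebraMap]⟩
    | add a b ha hb =>
      obtain ⟨m, hm⟩ := ha
      obtain ⟨n, hn⟩ := hb
      exact ⟨m + n, by rw [map_add, hm, hn, T_add]⟩
    | mul a b ha hb =>
      obtain ⟨m, hm⟩ := ha
      obtain ⟨n, hn⟩ := hb
      exact ⟨_, by rw [map_mul, hm, hn, T_mul]⟩
  have D_mul (a b : A) : D (a * b) =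
      (a ⊗ₜ 1 : A ⊗[k] Aᵐᵒᵖ) • D b + (1 ⊗ₜ op b : A ⊗[k] Aᵐᵒᵖ) • D a :=
    hD _ _ (by rw [map_mul, hf a, hf b, T_mul])
  let r : A ⊗[k] Aᵐᵒᵖ →ₗ[k] N := TensorProduct.lift (LinearMap.mk₂ k
    (fun a b => (1 ⊗ₜ b : A ⊗[k] Aᵐᵒᵖ) • D a) (fun a a' b => by rw [map_add, smul_add])
    (fun c a b => by rw [map_smul, smul_comm])
    (fun a b b' => by rw [TensorProduct.tmul_add, add_smul])
    (fun c a b => by rw [TensorProduct.tmul_smul, smul_assoc]))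
  have r_tmul (a : A) (b : Aᵐᵒᵖ) : r (a ⊗ₜ b) = (1 ⊗ₜ b : A ⊗[k] Aᵐᵒᵖ) • D a := rfl
  have key (u : A ⊗[k] Aᵐᵒᵖ) (c : A) : r (u * (c ⊗ₜ 1 - 1 ⊗ₜ op c)) = u • D c := by
    induction u with
    | zero =>
      rw [zero_mul, map_zero]
      exact (zero_smul (A ⊗[k] Aᵐᵒᵖ) (D c)).symm
    | add u v hu hv => rw [add_mul, map_add, hu, hv, add_smul]
    | tmul a b => simp [mul_sub, r_tmul, D_mul, smul_smul]
  exact ⟨r, fun u => ⟨by rw [key, hD x m hx], by rw [key, hD y n hy]⟩⟩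

end IsAffinePresentation

section LengthTwoResolution

open Limits ZeroObject

variable {C : Type*} [Category* C] [Abelian C] {P₀ P₁ P₂ Z : C}

/-- The objects `… 0, 0, P₂, P₁, P₀` of a complex of length two. -/
def lengthTwoX (P₀ P₁ P₂ : C) : ℕ → C
  | 0 => P₀
  | 1 => P₁
  | 2 => P₂
  | _ + 3 => 0

/-- The differentials of a complex of length two. -/
def lengthTwoD (d₂ : P₂ ⟶ P₁) (d₁ : P₁ ⟶ P₀) :
    ∀ n, lengthTwoX P₀ P₁ P₂ (n + 1) ⟶ lengthTwoX P₀ P₁ P₂ n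
  | 0 => d₁
  | 1 => d₂
  | _ + 2 => 0

/-- The complex `0 ⟶ P₂ ⟶ P₁ ⟶ P₀`. -/
def lengthTwoComplex (d₂ : P₂ ⟶ P₁) (d₁ : P₁ ⟶ P₀) (w : d₂ ≫ d₁ = 0) : ChainComplex C ℕ :=
  ChainComplex.of (lengthTwoX P₀ P₁ P₂) (lengthTwoD d₂ d₁) (by
    rintro (_ | _ | n)
    exacts [w, zero_comp, zero_comp])

theorem lengthTwoComplex_d (d₂ : P₂ ⟶ P₁) (d₁ : P₁ ⟶ P₀) (w : d₂ ≫ d₁ = 0) (n : ℕ) :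
    (lengthTwoComplex d₂ d₁ w).d (n + 1) n = lengthTwoD d₂ d₁ n :=
  ChainComplex.of_d _ _ _

/-- The projective resolution given by an exact sequence `0 ⟶ P₂ ⟶ P₁ ⟶ P₀ ⟶ Z ⟶ 0` with
projective `Pᵢ`. -/
def projectiveResolutionOfLengthTwo (d₂ : P₂ ⟶ P₁) (d₁ : P₁ ⟶ P₀) (ε : P₀ ⟶ Z)
    [Projective P₀] [Projective P₁] [Projective P₂] [Mono d₂] [Epi ε]
    (w₁ : d₂ ≫ d₁ = 0) (w₀ : d₁ ≫ ε = 0) (h₁ : (ShortComplex.mk d₂ d₁ w₁).Exact)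
    (h₀ : (ShortComplex.mk d₁ ε w₀).Exact) : ProjectiveResolution Z where
  complex := lengthTwoComplex d₂ d₁ w₁
  projective := by
    rintro (_ | _ | _ | n)
    exacts [‹Projective P₀›, ‹Projective P₁›, ‹Projective P₂›, (isZero_zero C).projective]
  π := (ChainComplex.toSingle₀Equiv _ _).symm ⟨ε, by
    rw [lengthTwoComplex_d]
    exact w₀⟩
  quasiIso := ⟨fun n => by
    cases n with
    | zero =>
      have hε := ChainComplex.toSingle₀Equiv_symm_apply_f_zero
        (C := lengthTwoComplex d₂ d₁ w₁) ε (by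
          rw [lengthTwoComplex_d]
          exact w₀)
      rw [ChainComplex.quasiIsoAt₀_iff, ShortComplex.quasiIso_iff_of_zeros']
      · refine (ShortComplex.exact_and_epi_g_iff_of_iso ?_).2 ⟨h₀, ‹Epi ε›⟩
        exact ShortComplex.isoMk (Iso.refl _) (Iso.refl _) (Iso.refl _)
          ((Category.id_comp _).trans
            ((lengthTwoComplex_d d₂ d₁ w₁ 0).symm.trans (Category.comp_id _).symm))
          (by
            refine (Category.id_comp _).trans ?_
            refine Eq.trans ?_ (Category.comp_id _).symm
            exact hε.symm)
      all_goals rfl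
    | succ n =>
      rw [quasiIsoAt_iff_exactAt' _ _ (ChainComplex.exactAt_succ_single_obj _ _),
        HomologicalComplex.exactAt_iff' _ (n + 1 + 1) (n + 1) n (by simp) (by simp)]
      simp only [HomologicalComplex.sc', HomologicalComplex.shortComplexFunctor',
        lengthTwoComplex, ChainComplex.of_d]
      match n with
      | 0 => exact h₁
      | 1 => exact (ShortComplex.exact_iff_mono _ rfl).mpr ‹Mono d₂›
      | _ + 2 => exact ShortComplex.exact_of_isZero_X₂ _ (isZero_zero C)⟩

end LengthTwoResolution

section KoszulResolution

/-- The elements `a`, `b`, `c`, `d` of `E` and `z` of `Z` define a free resolution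
`0 ⟶ E ⟶ E × E ⟶ E ⟶ Z ⟶ 0`, with maps `1 ↦ (a, b)`, `(u, v) ↦ u * c + v * d` and `1 ↦ z`.
Exactness at `E × E` is expressed by the existence of retractions. -/
structure IsKoszulResolution {E Z : Type} [Ring E] [AddCommGroup Z] [Module E Z]
    (a b c d : E) (z : Z) : Prop where
  mul_add_mul : a * c + b * d = 0
  smul_left : c • z = 0
  smul_right : d • z = 0
  eq_zero_of_mul_eq_zero : ∀ u, u * a = 0 → u = 0
  exists_retraction : ∀ {N : Type} [AddCommGroup N] [Module E N] (m n : N), a • m + b • n = 0 →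
    ∃ r : E →+ N, ∀ u, r (u * c) = u • m ∧ r (u * d) = u • n
  exists_of_smul_eq_zero : ∀ u : E, u • z = 0 → ∃ p q, p * c + q * d = u
  exists_smul_eq : ∀ w : Z, ∃ u : E, u • z = w

namespace IsKoszulResolution

open Limits ZeroObject

variable {E Z : Type} [Ring E] [AddCommGroup Z] [Module E Z] {a b c d : E} {z : Z}

theorem exact_toSpanSingleton_coprod (h : IsKoszulResolution a b c d z) :
    Function.Exact (LinearMap.toSpanSingleton E (E × E) (a, b))
      ((LinearMap.toSpanSingleton E E c).coprod (LinearMap.toSpanSingleton E E d)) := by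
  intro p
  refine ⟨fun hp => ?_, ?_⟩
  · let S := LinearMap.range (LinearMap.toSpanSingleton E (E × E) (a, b))
    have hS (q) : S.mkQ q = q.1 • S.mkQ (1, 0) + q.2 • S.mkQ (0, 1) := by
      rw [← map_smul, ← map_smul, ← map_add]
      simp
    obtain ⟨r, hr⟩ := h.exists_retraction (S.mkQ (1, 0)) (S.mkQ (0, 1)) (by
      rw [← hS (a, b)]
      exact (Submodule.Quotient.mk_eq_zero S).mpr ⟨1, by simp⟩)
    refine (Submodule.Quotient.mk_eq_zero S).mp ?_
    change S.mkQ p = 0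
    have hp' : p.1 * c + p.2 * d = 0 := hp
    rw [hS, ← (hr p.1).1, ← (hr p.2).2, ← map_add, hp', map_zero]
  · rintro ⟨u, rfl⟩
    simp [mul_assoc, ← mul_add, h.mul_add_mul]

theorem exact_coprod_toSpanSingleton (h : IsKoszulResolution a b c d z) :
    Function.Exact ((LinearMap.toSpanSingleton E E c).coprod (LinearMap.toSpanSingleton E E d))
      (LinearMap.toSpanSingleton E Z z) := by
  intro u
  refine ⟨fun hu => ?_, ?_⟩
  · obtain ⟨p, q, hpq⟩ := h.exists_of_smul_eq_zero u hu
    exact ⟨(p, q), hpq⟩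
  · rintro ⟨p, rfl⟩
    simp [add_smul, mul_smul, h.smul_left, h.smul_right]

/-- The projective resolution attached to Koszul data. -/
def projectiveResolution (h : IsKoszulResolution a b c d z) :
    ProjectiveResolution (ModuleCat.of E Z) :=
  have : Mono (ModuleCat.ofHom (LinearMap.toSpanSingleton E (E × E) (a, b))) :=
    (ModuleCat.mono_iff_injective _).mpr ((injective_iff_map_eq_zero _).mpr fun u hu =>
      h.eq_zero_of_mul_eq_zero u (congrArg Prod.fst hu))
  have : Epi (ModuleCat.ofHom (LinearMap.toSpanSingleton E Z z)) :=
    (ModuleCat.epi_iff_surjective _).mpr h.exists_smul_eq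
  projectiveResolutionOfLengthTwo
    (ModuleCat.ofHom (LinearMap.toSpanSingleton E (E × E) (a, b)))
    (ModuleCat.ofHom
      ((LinearMap.toSpanSingleton E E c).coprod (LinearMap.toSpanSingleton E E d)))
    (ModuleCat.ofHom (LinearMap.toSpanSingleton E Z z))
    (ModuleCat.hom_ext h.exact_toSpanSingleton_coprod.linearMap_comp_eq_zero)
    (ModuleCat.hom_ext h.exact_coprod_toSpanSingleton.linearMap_comp_eq_zero)
    ((ShortComplex.ShortExact.moduleCat_exact_iff_function_exact _).mpr
      h.exact_toSpanSingleton_coprod)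
    ((ShortComplex.ShortExact.moduleCat_exact_iff_function_exact _).mpr
      h.exact_coprod_toSpanSingleton)

variable {k : Type} [Field k] [Algebra k E]

theorem isZero_linearYonedaObj_X (h : IsKoszulResolution a b c d z) (M : ModuleCat.{0} E)
    (n : ℕ) : IsZero ((h.projectiveResolution.complex.linearYonedaObj k M).X (n + 3)) := by
  have : Subsingleton ((h.projectiveResolution.complex.linearYonedaObj k M).X (n + 3)) :=
    ⟨fun f g => (isZero_zero (ModuleCat.{0} E)).eq_of_src
      (f : (0 : ModuleCat.{0} E) ⟶ M) g⟩
  exact ModuleCat.isZero_of_subsingleton _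

theorem isZero_Ext_add_three (h : IsKoszulResolution a b c d z) (M : ModuleCat.{0} E) (n : ℕ) :
    IsZero (((Ext k (ModuleCat.{0} E) (n + 3)).obj
      (Opposite.op (ModuleCat.of E Z))).obj M) := by
  refine IsZero.of_iso ?_ (h.projectiveResolution.isoExt (n + 3) M)
  rw [← HomologicalComplex.exactAt_iff_isZero_homology, HomologicalComplex.exactAt_iff]
  exact ShortComplex.exact_of_isZero_X₂ _ (h.isZero_linearYonedaObj_X M n)

theorem nontrivial_Ext_two (h : IsKoszulResolution a b c d z) (M : ModuleCat.{0} E)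
    [Nontrivial M] (ha : ∀ m : M, a • m = 0) (hb : ∀ m : M, b • m = 0) :
    Nontrivial (((Ext k (ModuleCat.{0} E) 2).obj (Opposite.op (ModuleCat.of E Z))).obj M) := by
  let K := h.projectiveResolution.complex.linearYonedaObj k M
  have hd : K.d 1 2 = 0 := by
    refine ModuleCat.hom_ext (LinearMap.ext fun f => ?_)
    change h.projectiveResolution.complex.d 2 1 ≫ f = 0
    have hd₂ : h.projectiveResolution.complex.d 2 1 =
        ModuleCat.ofHom (LinearMap.toSpanSingleton E (E × E) (a, b)) :=
      lengthTwoComplex_d _ _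
        (ModuleCat.hom_ext h.exact_toSpanSingleton_coprod.linearMap_comp_eq_zero) 1
    rw [hd₂]
    let g : ModuleCat.of E (E × E) ⟶ M := f
    change ModuleCat.ofHom (LinearMap.toSpanSingleton E (E × E) (a, b)) ≫ g = 0
    refine ModuleCat.hom_ext (LinearMap.ext_ring ?_)
    have hg : g.hom (a, b) = a • g.hom (1, 0) + b • g.hom (0, 1) := by
      rw [← map_smul, ← map_smul, ← map_add]
      simp
    simp [hg, ha, hb]
  by_contra hM
  rw [not_nontrivial_iff_subsingleton] at hM
  have hexact : IsZero (K.homology 2) :=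
    (ModuleCat.isZero_of_subsingleton _).of_iso (h.projectiveResolution.isoExt 2 M).symm
  rw [← HomologicalComplex.exactAt_iff_isZero_homology,
    HomologicalComplex.exactAt_iff' _ 1 2 3 (by simp) (by simp)] at hexact
  have : Mono (K.d 2 3) := hexact.mono_g hd
  have hX : IsZero (K.X 2) := (h.isZero_linearYonedaObj_X M 0).of_mono (K.d 2 3)
  have hsub : Subsingleton (ModuleCat.of E E ⟶ M) := ModuleCat.subsingleton_of_isZero hX
  obtain ⟨m, hm⟩ := exists_ne (0 : M)
  refine hm ?_
  have := congrArg (fun f : ModuleCat.of E E ⟶ M => f.hom 1)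
    (hsub.elim (ModuleCat.ofHom (LinearMap.toSpanSingleton E M m)) 0)
  simpa using this

end IsKoszulResolution

end KoszulResolution

open MulOpposite in
/-- The Koszul resolution of `A` as a bimodule over itself. -/
theorem IsAffinePresentation.isKoszulResolution {k A : Type} [CommRing k] [Ring A] [Algebra k A]
    {x y : A} (h : IsAffinePresentation k x y) :
    IsKoszulResolution (1 ⊗ₜ op y - y ⊗ₜ 1 - 1) (x ⊗ₜ 1 - 1 ⊗ₜ op x)
      (x ⊗ₜ 1 - 1 ⊗ₜ op x) (y ⊗ₜ 1 - 1 ⊗ₜ op y : A ⊗[k] Aᵐᵒᵖ) (1 : A) where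
  mul_add_mul := by
    simp only [mul_sub, sub_mul, Algebra.TensorProduct.tmul_mul_tmul, mul_one, one_mul, ← op_mul,
      h.rel, MulOpposite.op_add, TensorProduct.tmul_add, TensorProduct.add_tmul]
    abel
  smul_left := by simp [sub_smul, TensorProduct.Algebra.smul_def]
  smul_right := by simp [sub_smul, TensorProduct.Algebra.smul_def]
  eq_zero_of_mul_eq_zero := h.eq_zero_of_mul_eq_zero
  exists_retraction := by
    intro N _ _ m n hmn
    let : Module k N := Module.compHom N (algebraMap k (A ⊗[k] Aᵐᵒᵖ))
    have : IsScalarTower k (A ⊗[k] Aᵐᵒᵖ) N :=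
      ⟨fun c u n => (congrArg (· • n) (Algebra.smul_def c u)).trans (mul_smul _ u n)⟩
    obtain ⟨r, hr⟩ := h.exists_retraction m n hmn
    exact ⟨r.toAddMonoidHom, hr⟩
  exists_of_smul_eq_zero := fun u hu =>
    Ideal.mem_span_pair.mp (h.mem_span_of_smul_one_eq_zero u hu)
  exists_smul_eq := fun a => ⟨a ⊗ₜ 1, by simp [TensorProduct.Algebra.smul_def]⟩

theorem isAffinePresentation_A1 : IsAffinePresentation ℂ (mkA 1 Xgen) (mkA 1 Ygen) where
  rel := by
    have := RingQuot.mkAlgHom_rel ℂ (s := relA 1) ⟨rfl, rfl⟩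
    simpa [mkA] using this
  adjoin_eq_top := by
    have hs : Function.Surjective (mkA 1) := RingQuot.mkAlgHom_surjective ℂ (relA 1)
    rw [← Set.image_pair, ← AlgHom.map_adjoin, eq_top_iff, ← (AlgHom.range_eq_top _).mpr hs,
      ← Algebra.map_top, ← FreeAlgebra.adjoin_range_ι]
    refine Subalgebra.map_mono (Algebra.adjoin_mono ?_)
    rintro _ ⟨i, rfl⟩
    fin_cases i
    exacts [Or.inl rfl, Or.inr rfl]
  exists_lift := by
    intro B _ _ u v huv
    refine ⟨RingQuot.liftAlgHom ℂ ⟨FreeAlgebra.lift ℂ ![u, v], ?_⟩, ?_, ?_⟩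
    · rintro _ _ ⟨rfl, rfl⟩
      simp [Xgen, Ygen, huv]
    · simp [mkA, Xgen]
    · simp [mkA, Ygen]

theorem exists_nontrivial_HH1alg_two : ∃ M : ModuleCat.{0} A1e, Nontrivial (HH1alg 2 M) := by
  obtain ⟨f, hfx, hfy⟩ := isAffinePresentation_A1.exists_lift (0 : ℂ) 0 (by simp)
  obtain ⟨g, hgx, hgy⟩ := isAffinePresentation_A1.exists_lift (0 : ℂ) 1 (by simp)
  let χ : A1e →ₐ[ℂ] ℂ := Algebra.TensorProduct.lift f
    (g.fromOpposite fun _ _ => Commute.all _ _) fun _ _ => Commute.all _ _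
  let : Module A1e ℂ := Module.compHom ℂ χ.toRingHom
  have hχ (u : A1e) (c : ℂ) : u • c = χ u * c := rfl
  have : Nontrivial (ModuleCat.of A1e ℂ) := inferInstanceAs (Nontrivial ℂ)
  refine ⟨ModuleCat.of A1e ℂ, isAffinePresentation_A1.isKoszulResolution.nontrivial_Ext_two _
    (fun m => ?_) (fun m => ?_)⟩
  · refine (hχ _ _).trans ?_
    simp [χ, hfy, hgy]
  · refine (hχ _ _).trans ?_
    simp [χ, hfx, hgx]

/-- There is an `(A_1,A_1)`-bimodule `M` with `HH^2(A_1, M) ≠ 0`; hence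
`HCDim(A_1) = 2`. -/
theorem HH2_A1_nonzero_and_HCDim :
    (∃ M : ModuleCat.{0} A1e, Nontrivial (HH1alg 2 M)) ∧ HCDimA1 = 2 := by
  refine ⟨exists_nontrivial_HH1alg_two, le_antisymm (sSup_le ?_) (le_sSup
    ⟨2, rfl, exists_nontrivial_HH1alg_two⟩)⟩
  rintro _ ⟨n, rfl, M, hM⟩
  by_contra! hn
  have hn' : 3 ≤ n := by exact_mod_cast hn
  obtain ⟨m, rfl⟩ := Nat.exists_eq_add_of_le' hn'
  have := ModuleCat.subsingleton_of_isZero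
    (isAffinePresentation_A1.isKoszulResolution.isZero_Ext_add_three (k := ℂ) M m)
  exact not_subsingleton_iff_nontrivial.mpr hM this
end
end
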